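/- The Milnor ring Q_W = ℂ[X1, X2]/Jac(W) of the two-dimensional loop potential W is a finite-dimensional ℂ-vector space of dimension a1*a2. -/

import Mathlib

noncomputable section

open MvPolynomial

/-- The two-dimensional loop potential `W = X1^a1 * X2 + X2^a2 * X1`. -/
def loopPotential (a1 a2 : ℕ) : MvPolynomial (Fin 2) ℂ :=
  X 0 ^ a1 * X 1 + X 1 ^ a2 * X 0

/-- The Jacobian ideal of the loop potential. -/
def loopJac (a1 a2 : ℕ) : Ideal (MvPolynomial (Fin 2) ℂ) :=
  Ideal.span {pderiv 0 (loopPotential a1 a2), pderiv 1 (loopPotential a1 a2)}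

def lpE (a b i j : ℕ) : Fin a × Fin b → ℂ :=
  fun p => if (p.1 : ℕ) = i ∧ (p.2 : ℕ) = j then 1 else 0

def lpN (a b i j : ℕ) : Fin a × Fin b → ℂ :=
  lpE a b i j + (if j = 0 ∧ a ≤ i then (-(b : ℂ)) • lpE a b (i - a + 1) (b - 1) else 0)
    + (if i = 0 ∧ b ≤ j then (-(a : ℂ)) • lpE a b (a - 1) (j - b + 1) else 0)

def lpNF (a b : ℕ) : MvPolynomial (Fin 2) ℂ →ₗ[ℂ] (Fin a × Fin b → ℂ) :=
  (basisMonomials (Fin 2) ℂ).constr ℂ (fun s => lpN a b (s 0) (s 1))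

def lpS (a b : ℕ) : (Fin a × Fin b → ℂ) →ₗ[ℂ] MvPolynomial (Fin 2) ℂ :=
  Fintype.linearCombination ℂ (fun p => X 0 ^ (p.1 : ℕ) * X 1 ^ (p.2 : ℕ))

lemma lpE_zero {a b i j : ℕ} (h : a ≤ i ∨ b ≤ j) : lpE a b i j = 0 := by
  funext p
  have h1 := p.1.2
  have h2 := p.2.2
  simp only [lpE, Pi.zero_apply, ite_eq_right_iff]
  omega

lemma lpMon (s : Fin 2 →₀ ℕ) :
    (monomial s (1 : ℂ)) = X 0 ^ (s 0) * X 1 ^ (s 1) := by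
  rw [monomial_eq, Finsupp.prod_fintype _ _ (by simp)]
  simp

lemma lpNF_mon (a b i j : ℕ) : lpNF a b (X 0 ^ i * X 1 ^ j) = lpN a b i j := by
  have h := (basisMonomials (Fin 2) ℂ).constr_basis ℂ
    (fun s => lpN a b (s 0) (s 1)) (Finsupp.single 0 i + Finsupp.single 1 j)
  rw [coe_basisMonomials] at h
  beta_reduce at h
  rw [lpMon] at h
  simpa [lpNF] using h

lemma lpS_E {a b i j : ℕ} (hi : i < a) (hj : j < b) :
    lpS a b (lpE a b i j) = X 0 ^ i * X 1 ^ j := by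
  rw [lpS, Fintype.linearCombination_apply,
    Finset.sum_eq_single ((⟨i, hi⟩, ⟨j, hj⟩) : Fin a × Fin b)]
  · simp [lpE]
  · rintro ⟨p, q⟩ _ hne
    have : ¬ ((p : ℕ) = i ∧ (q : ℕ) = j) := by
      rintro ⟨rfl, rfl⟩
      exact hne rfl
    simp [lpE, this]
  · simp

lemma lpJac_eq {a b : ℕ} :
    loopJac a b = Ideal.span {(C (a : ℂ)) * (X 0 ^ (a - 1) * X 1) + X 1 ^ b,
      X 0 ^ a + C (b : ℂ) * (X 1 ^ (b - 1) * X 0)} := by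
  have e0 : pderiv 0 (loopPotential a b)
      = (C (a : ℂ)) * (X 0 ^ (a - 1) * X 1) + X 1 ^ b := by
    simp [loopPotential, Derivation.leibniz, Derivation.leibniz_pow, pderiv_X]
    ring
  have e1 : pderiv 1 (loopPotential a b)
      = X 0 ^ a + C (b : ℂ) * (X 1 ^ (b - 1) * X 0) := by
    simp [loopPotential, Derivation.leibniz, Derivation.leibniz_pow, pderiv_X]
    ring
  rw [loopJac, e0, e1]

lemma lpKill {a b : ℕ} (f : MvPolynomial (Fin 2) ℂ)
    (h : ∀ m n, lpNF a b (X 0 ^ m * X 1 ^ n * f) = 0) (p : MvPolynomial (Fin 2) ℂ) :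
    lpNF a b (p * f) = 0 := by
  induction p using MvPolynomial.induction_on' with
  | monomial s c =>
    have : monomial s c = c • monomial s (1 : ℂ) := by simp [smul_monomial]
    rw [this, lpMon, smul_mul_assoc, map_smul, h, smul_zero]
  | add p q hp hq => rw [add_mul, map_add, hp, hq, add_zero]

lemma lpJac_le {a b : ℕ} (ha : 2 ≤ a) (hb : 2 ≤ b) (p : MvPolynomial (Fin 2) ℂ)
    (hp : p ∈ loopJac a b) : lpNF a b p = 0 := by
  rw [lpJac_eq, Ideal.mem_span_pair] at hp
  obtain ⟨u, v, rfl⟩ := hp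
  rw [map_add, lpKill _ _ u, lpKill _ _ v, add_zero]
  · intro m n
    have : (X 0 ^ m * X 1 ^ n * (X 0 ^ a + C (b : ℂ) * (X 1 ^ (b - 1) * X 0))
        : MvPolynomial (Fin 2) ℂ)
        = X 0 ^ (m + a) * X 1 ^ n + (b : ℂ) • (X 0 ^ (m + 1) * X 1 ^ (n + (b - 1))) := by
      rw [smul_eq_C_mul]; ring
    rw [this, map_add, map_smul, lpNF_mon, lpNF_mon, lpN, lpN]
    rw [lpE_zero (i := m + a) (by omega), if_neg (by omega : ¬ (m + a = 0 ∧ _)),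
      if_neg (by omega : ¬ (n + (b - 1) = 0 ∧ _)), if_neg (by omega : ¬ (m + 1 = 0 ∧ _))]
    by_cases hn : n = 0
    · subst hn
      simp
    · rw [if_neg (by omega), lpE_zero (j := n + (b - 1)) (by omega)]
      simp
  · intro m n
    have : (X 0 ^ m * X 1 ^ n * ((C (a : ℂ)) * (X 0 ^ (a - 1) * X 1) + X 1 ^ b)
        : MvPolynomial (Fin 2) ℂ)
        = (a : ℂ) • (X 0 ^ (m + (a - 1)) * X 1 ^ (n + 1)) + X 0 ^ m * X 1 ^ (n + b) := by
      rw [smul_eq_C_mul]; ring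
    rw [this, map_add, map_smul, lpNF_mon, lpNF_mon, lpN, lpN]
    rw [lpE_zero (j := n + b) (by omega), if_neg (by omega : ¬ (n + b = 0 ∧ _)),
      if_neg (by omega : ¬ (m + (a - 1) = 0 ∧ _)), if_neg (by omega : ¬ (n + 1 = 0 ∧ _))]
    by_cases hm : m = 0
    · subst hm
      simp
    · rw [if_neg (by omega), lpE_zero (i := m + (a - 1)) (by omega)]
      simp

lemma lp_ab {a b : ℕ} (ha : 2 ≤ a) (hb : 2 ≤ b) : (1 - (a : ℂ) * b) ≠ 0 := by
  have : a * b ≠ 1 := by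
    intro h
    have := Nat.eq_one_of_mul_eq_one_right h
    omega
  intro h
  apply this
  have h2 : ((a * b : ℕ) : ℂ) = (1 : ℕ) := by
    push_cast
    linear_combination -h
  exact_mod_cast h2

lemma lpF_mem (a b : ℕ) :
    (C (a : ℂ)) * (X 0 ^ (a - 1) * X 1) + X 1 ^ b ∈ loopJac a b := by
  rw [lpJac_eq]; exact Ideal.subset_span (by simp)

lemma lpG_mem (a b : ℕ) :
    X 0 ^ a + C (b : ℂ) * (X 1 ^ (b - 1) * X 0) ∈ loopJac a b := by
  rw [lpJac_eq]; exact Ideal.subset_span (by simp)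

lemma lp_mem1 {a b : ℕ} (ha : 2 ≤ a) (hb : 2 ≤ b) : X 0 ^ a * X 1 ∈ loopJac a b := by
  have h := (loopJac a b).sub_mem ((loopJac a b).mul_mem_left (X 1) (lpG_mem a b))
    ((loopJac a b).mul_mem_left (C (b : ℂ) * X 0) (lpF_mem a b))
  have h2 := (loopJac a b).mul_mem_left (C (1 - (a : ℂ) * b)⁻¹) h
  convert h2 using 1
  have e : (C (1 - (a : ℂ) * b)⁻¹ : MvPolynomial (Fin 2) ℂ) * (1 - C (a : ℂ) * C (b : ℂ)) = 1 := by
    rw [← C_1, ← C_mul, ← C_sub, ← C_mul, inv_mul_cancel₀ (lp_ab ha hb)]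
  obtain ⟨a, rfl⟩ : ∃ k, a = k + 1 := ⟨a - 1, by omega⟩
  obtain ⟨b, rfl⟩ : ∃ k, b = k + 1 := ⟨b - 1, by omega⟩
  simp only [Nat.add_sub_cancel]
  linear_combination (-(X 0 ^ (a+1) * X 1 : MvPolynomial (Fin 2) ℂ)) * e

lemma lp_mem2 {a b : ℕ} (ha : 2 ≤ a) (hb : 2 ≤ b) : X 0 * X 1 ^ b ∈ loopJac a b := by
  have h := (loopJac a b).sub_mem ((loopJac a b).mul_mem_left (X 0) (lpF_mem a b))
    ((loopJac a b).mul_mem_left (C (a : ℂ)) (lp_mem1 ha hb))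
  convert h using 1
  obtain ⟨a, rfl⟩ : ∃ k, a = k + 1 := ⟨a - 1, by omega⟩
  simp only [Nat.add_sub_cancel]
  ring

lemma lp_mem1' {a b : ℕ} (ha : 2 ≤ a) (hb : 2 ≤ b) {i j : ℕ} (hi : a ≤ i) (hj : 1 ≤ j) :
    X 0 ^ i * X 1 ^ j ∈ loopJac a b := by
  have h := (loopJac a b).mul_mem_left (X 0 ^ (i - a) * X 1 ^ (j - 1)) (lp_mem1 ha hb)
  obtain ⟨i, rfl⟩ := Nat.exists_eq_add_of_le hi
  obtain ⟨j, rfl⟩ := Nat.exists_eq_add_of_le hj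
  simp only [Nat.add_sub_cancel_left] at h
  convert h using 1
  ring

lemma lp_mem2' {a b : ℕ} (ha : 2 ≤ a) (hb : 2 ≤ b) {i j : ℕ} (hi : 1 ≤ i) (hj : b ≤ j) :
    X 0 ^ i * X 1 ^ j ∈ loopJac a b := by
  have h := (loopJac a b).mul_mem_left (X 0 ^ (i - 1) * X 1 ^ (j - b)) (lp_mem2 ha hb)
  obtain ⟨i, rfl⟩ := Nat.exists_eq_add_of_le hi
  obtain ⟨j, rfl⟩ := Nat.exists_eq_add_of_le hj
  simp only [Nat.add_sub_cancel_left] at h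
  convert h using 1
  ring

lemma lpRed_mon {a b : ℕ} (ha : 2 ≤ a) (hb : 2 ≤ b) (i j : ℕ) :
    X 0 ^ i * X 1 ^ j - lpS a b (lpN a b i j) ∈ loopJac a b := by
  rw [lpN]
  by_cases hi : a ≤ i
  · rw [lpE_zero (Or.inl hi), if_neg (by omega : ¬ (i = 0 ∧ _))]
    by_cases hj : j = 0
    · subst hj
      rw [if_pos ⟨rfl, hi⟩, add_zero, zero_add, map_smul]
      obtain ⟨i, rfl⟩ := Nat.exists_eq_add_of_le hi
      simp only [Nat.add_sub_cancel_left]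
      have h := (loopJac a b).mul_mem_left (X 0 ^ i) (lpG_mem a b)
      by_cases h2 : i + 1 < a
      · rw [lpS_E h2 (by omega), smul_eq_C_mul]
        convert h using 1
        rw [C_neg]; ring
      · rw [lpE_zero (Or.inl (by omega)), map_zero, smul_zero, sub_zero]
        have h3 := (loopJac a b).mul_mem_left (C (b : ℂ))
          (lp_mem1' ha hb (i := i + 1) (j := b - 1) (by omega) (by omega))
        convert (loopJac a b).sub_mem h h3 using 1
        ring
    · rw [if_neg (by omega)]
      simpa using lp_mem1' ha hb hi (by omega)
  · rw [if_neg (by omega : ¬ (j = 0 ∧ _))]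
    by_cases hj : b ≤ j
    · rw [lpE_zero (Or.inr hj)]
      by_cases hi0 : i = 0
      · subst hi0
        rw [if_pos ⟨rfl, hj⟩, add_zero, zero_add, map_smul]
        obtain ⟨j, rfl⟩ := Nat.exists_eq_add_of_le hj
        simp only [Nat.add_sub_cancel_left]
        have h := (loopJac a b).mul_mem_left (X 1 ^ j) (lpF_mem a b)
        by_cases h2 : j + 1 < b
        · rw [lpS_E (by omega) h2, smul_eq_C_mul]
          convert h using 1
          rw [C_neg]; ring
        · rw [lpE_zero (Or.inr (by omega)), map_zero, smul_zero, sub_zero]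
          have h3 := (loopJac a b).mul_mem_left (C (a : ℂ))
            (lp_mem2' ha hb (i := a - 1) (j := j + 1) (by omega) (by omega))
          convert (loopJac a b).sub_mem h h3 using 1
          ring
      · rw [if_neg (by omega)]
        simpa using lp_mem2' ha hb (i := i) (by omega) hj
    · rw [if_neg (by omega), add_zero, add_zero, lpS_E (by omega) (by omega), sub_self]
      exact Ideal.zero_mem _

lemma lpRed {a b : ℕ} (ha : 2 ≤ a) (hb : 2 ≤ b) (p : MvPolynomial (Fin 2) ℂ) :
    p - lpS a b (lpNF a b p) ∈ loopJac a b := by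
  induction p using MvPolynomial.induction_on' with
  | monomial s c =>
    have : monomial s c = c • monomial s (1 : ℂ) := by simp [smul_monomial]
    rw [this, lpMon, map_smul, map_smul, lpNF_mon, ← smul_sub, smul_eq_C_mul]
    exact Ideal.mul_mem_left _ _ (lpRed_mon ha hb _ _)
  | add p q hp hq =>
    rw [map_add, map_add, add_sub_add_comm]
    exact Ideal.add_mem _ hp hq

lemma lpSurj (a b : ℕ) : Function.Surjective (lpNF a b) := by
  intro t
  refine ⟨lpS a b t, ?_⟩
  rw [lpS, Fintype.linearCombination_apply, map_sum]
  funext q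
  rw [Finset.sum_apply, Finset.sum_eq_single q]
  · have h1 := q.1.2
    have h2 := q.2.2
    rw [map_smul, lpNF_mon, lpN, if_neg (by omega), if_neg (by omega)]
    simp [lpE]
  · intro p _ hne
    have h1 := p.1.2
    have h2 := p.2.2
    rw [map_smul, lpNF_mon, lpN, if_neg (by omega), if_neg (by omega)]
    have : ¬ ((q.1 : ℕ) = p.1 ∧ (q.2 : ℕ) = p.2) := by
      rintro ⟨h, h'⟩
      exact hne (Prod.ext (Fin.ext h.symm) (Fin.ext h'.symm))
    simp [lpE, this]
  · simp

/-- The Milnor ring `Q_W = ℂ[X1,X2]/Jac(W)` of the loop potential is a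
finite-dimensional `ℂ`-vector space of dimension `a1*a2`. -/
theorem loopMilnor_finrank (a1 a2 : ℕ) (ha1 : 2 ≤ a1) (ha2 : 2 ≤ a2) :
    FiniteDimensional ℂ (MvPolynomial (Fin 2) ℂ ⧸ loopJac a1 a2) ∧
    Module.finrank ℂ (MvPolynomial (Fin 2) ℂ ⧸ loopJac a1 a2) = a1 * a2 := by
  have hk : (loopJac a1 a2).restrictScalars ℂ = LinearMap.ker (lpNF a1 a2) := by
    ext p
    rw [Submodule.restrictScalars_mem, LinearMap.mem_ker]
    refine ⟨lpJac_le ha1 ha2 p, fun h => ?_⟩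
    have := lpRed ha1 ha2 p
    rwa [h, map_zero, sub_zero] at this
  have e : (MvPolynomial (Fin 2) ℂ ⧸ loopJac a1 a2) ≃ₗ[ℂ] (Fin a1 × Fin a2 → ℂ) :=
    (Submodule.Quotient.restrictScalarsEquiv ℂ (loopJac a1 a2)).symm.trans
      ((Submodule.quotEquivOfEq _ _ hk).trans
        ((lpNF a1 a2).quotKerEquivOfSurjective (lpSurj a1 a2)))
  refine ⟨Module.Finite.equiv e.symm, ?_⟩
  rw [e.finrank_eq]
  simp

end
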